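/- For every finite partition of the set of integers into finitely many cells, at least one cell contains arbitrarily long arithmetic progressions; that is, for every r ≥ 1, every coloring c : ℤ → {1,…,r}, and every k ∈ ℕ, there exist a ∈ ℤ and d ≥ 1 such that c(a) = c(a+d) = ⋯ = c(a+(k−1)d). -/

import Mathlib

/-- **van der Waerden's theorem** for the integers: for every finite coloring
`c : ℤ → Fin r` (with `r ≥ 1`) and every length `k`, some color class contains
an arithmetic progression `a, a+d, …, a+(k-1)d` with common difference `d ≥ 1`. -/
theorem vanDerWaerden_int (r : ℕ) (hr : 1 ≤ r) (c : ℤ → Fin r) (k : ℕ) :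
    ∃ (a d : ℤ), 1 ≤ d ∧ ∀ i : ℕ, i < k → c (a + (i : ℤ) * d) = c a := by
  obtain ⟨n, hn, b, color, hmono⟩ :=
    Combinatorics.exists_mono_homothetic_copy ((Finset.range k).image (Nat.cast : ℕ → ℤ)) c
  have hcolor : ∀ i : ℕ, i < k → c (b + (i : ℤ) * n) = color := fun i hi => by
    have h := hmono i (Finset.mem_image_of_mem _ (Finset.mem_range.mpr hi))
    rwa [nsmul_eq_mul, mul_comm, add_comm] at h
  refine ⟨b, n, by exact_mod_cast hn, fun i hi => ?_⟩
  have h₀ := hcolor 0 (Nat.zero_lt_of_lt hi)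
  rw [Nat.cast_zero, zero_mul, add_zero] at h₀
  rw [hcolor i hi, h₀]
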